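/- Let f : ℤ_2 → ℤ_2 be a 1-Lipschitz function (T-function) with van der Put series f(x) = Σ_{m=0}^∞ B_m·χ(m,x). Then f is transitive modulo 2^k for every k ≥ 1 (i.e., f is ergodic) if and only if the following conditions hold simultaneously: (1) B_0 ≡ 1 (mod 2); (2) B_0 + B_1 ≡ 3 (mod 4); (3) |B_m|_2 = 2^{−(n−1)} whenever n ≥ 2 and 2^{n−1} ≤ m < 2^n − 1; (4) |Σ_{m=2^{n−1}}^{2^n−1} (B_m − 2^{n−1})|_2 ≤ 2^{−(n+1)} for every n ≥ 2. -/

import Mathlib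

open Filter

/-- The map induced by `f : ℤ_[2] → ℤ_[2]` on `ℤ/2^kℤ` (for 1-Lipschitz `f` this is the
well-defined reduction of `f` modulo `2^k`). -/
noncomputable def inducedMod (f : ℤ_[2] → ℤ_[2]) (k : ℕ) : ZMod (2 ^ k) → ZMod (2 ^ k) :=
  fun z => PadicInt.toZModPow k (f ((z.val : ℤ_[2])))

/-- `f` is transitive modulo `2^k`: the orbit of `0` under the induced map on `ℤ/2^kℤ` is
all of `ℤ/2^kℤ`. -/
def TransitiveMod (f : ℤ_[2] → ℤ_[2]) (k : ℕ) : Prop :=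
  ∀ z : ZMod (2 ^ k), ∃ n : ℕ, (inducedMod f k)^[n] 0 = z

/-- The van der Put characteristic function `χ(m,·)`: the characteristic function (with values
in `{0,1} ⊆ ℤ_2`) of the ball `m + 2^{⌊log_2 m⌋+1}ℤ_2`, with the convention `⌊log_2 0⌋ = 0`. -/
noncomputable def vdpChi (m : ℕ) (x : ℤ_[2]) : ℤ_[2] :=
  if ‖x - (m : ℤ_[2])‖ ≤ (2 : ℝ) ^ (-((Nat.log 2 m : ℤ) + 1)) then 1 else 0

theorem PadicInt.two_pow_dvd_iff_norm_le (n : ℕ) (x : ℤ_[2]) :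
    2 ^ n ∣ x ↔ ‖x‖ ≤ (2 : ℝ) ^ (-(n : ℤ)) := by
  have h := PadicInt.norm_le_pow_iff_mem_span_pow x n
  rw [Ideal.mem_span_singleton] at h
  exact_mod_cast h.symm

theorem PadicInt.norm_eq_two_zpow_iff (n : ℕ) (x : ℤ_[2]) :
    ‖x‖ = (2 : ℝ) ^ (-(n : ℤ)) ↔ 2 ^ n ∣ x ∧ ¬ 2 ^ (n + 1) ∣ x := by
  have h := PadicInt.norm_le_pow_iff_norm_lt_pow_add_one x (-((n + 1 : ℕ) : ℤ))
  have e : -((n + 1 : ℕ) : ℤ) + 1 = -(n : ℤ) := by push_cast; ring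
  rw [e] at h
  rw [two_pow_dvd_iff_norm_le, two_pow_dvd_iff_norm_le]
  push_cast at h ⊢
  rw [h, not_lt]
  exact le_antisymm_iff

theorem PadicInt.two_pow_dvd_natCast (n m : ℕ) : (2 : ℤ_[2]) ^ n ∣ m ↔ 2 ^ n ∣ m := by
  have h := PadicInt.pow_p_dvd_int_iff (p := 2) n m
  exact_mod_cast h

theorem PadicInt.toZModPow_two_eq_iff (n : ℕ) (x y : ℤ_[2]) :
    PadicInt.toZModPow n x = PadicInt.toZModPow n y ↔ 2 ^ n ∣ x - y := by
  rw [← sub_eq_zero, ← map_sub, ← RingHom.mem_ker, PadicInt.ker_toZModPow,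
    Ideal.mem_span_singleton]
  norm_cast

theorem PadicInt.two_pow_dvd_sub_appr (n : ℕ) (x : ℤ_[2]) : 2 ^ n ∣ x - x.appr n := by
  have h := PadicInt.appr_spec n x
  rw [Ideal.mem_span_singleton] at h
  exact_mod_cast h

theorem PadicInt.two_dvd_or_two_dvd_sub_one (x : ℤ_[2]) : 2 ∣ x ∨ 2 ∣ x - 1 := by
  have h := two_pow_dvd_sub_appr 1 x
  have hlt := x.appr_lt 1
  rw [pow_one] at h
  interval_cases x.appr 1
  · left; simpa using h
  · right; simpa using h

/-- The residue modulo `2 ^ (n + 1)` of an element of exact valuation `n` is `2 ^ n`. -/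
theorem PadicInt.two_pow_succ_dvd_sub_two_pow {n : ℕ} {x : ℤ_[2]} (h : 2 ^ n ∣ x)
    (h' : ¬ 2 ^ (n + 1) ∣ x) : 2 ^ (n + 1) ∣ x - 2 ^ n := by
  obtain ⟨c, rfl⟩ := h
  rw [pow_succ] at *
  rcases two_dvd_or_two_dvd_sub_one c with hc | hc
  · exact absurd (mul_dvd_mul_left _ hc) h'
  · rw [← mul_sub_one]
    exact mul_dvd_mul_left _ hc

theorem PadicInt.not_two_pow_succ_dvd_two_pow (n : ℕ) : ¬ (2 : ℤ_[2]) ^ (n + 1) ∣ 2 ^ n := by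
  have h := two_pow_dvd_natCast (n + 1) (2 ^ n)
  push_cast at h
  rw [h, Nat.pow_dvd_pow_iff_le_right (by norm_num)]
  omega

open PadicInt

/-- `f` respects congruences modulo powers of `2`. -/
def CongrPreserving (f : ℤ_[2] → ℤ_[2]) : Prop :=
  ∀ (n : ℕ) (x y : ℤ_[2]), 2 ^ n ∣ x - y → 2 ^ n ∣ f x - f y

/-- Modulo `2 ^ n`, the orbit of `0` under `f` is periodic of exact period `2 ^ n`. -/
def FullPeriod (f : ℤ_[2] → ℤ_[2]) (n : ℕ) : Prop :=
  ∀ i : ℕ, 2 ^ n ∣ f^[i] 0 ↔ 2 ^ n ∣ i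

/-- Modulo `2 ^ (n + 1)`, the map `f` commutes with translation by `2 ^ n`. -/
def CommutesTranslation (f : ℤ_[2] → ℤ_[2]) (n : ℕ) : Prop :=
  ∀ x y : ℤ_[2], 2 ^ n ∣ x - y → 2 ^ (n + 1) ∣ (f x - f y) - (x - y)

/-- The sum of the displacements of `0, …, 2 ^ n - 1` under `f`. -/
noncomputable def displacementSum (f : ℤ_[2] → ℤ_[2]) (n : ℕ) : ℤ_[2] :=
  ∑ r ∈ Finset.range (2 ^ n), (f r - r)

section Dynamics

variable {f : ℤ_[2] → ℤ_[2]} {n : ℕ}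

theorem CongrPreserving.of_norm_le (hf : ∀ a b : ℤ_[2], ‖f a - f b‖ ≤ ‖a - b‖) :
    CongrPreserving f := by
  intro n x y h
  rw [two_pow_dvd_iff_norm_le] at *
  exact (hf x y).trans h

theorem CongrPreserving.iterate (hf : CongrPreserving f) (i : ℕ) : CongrPreserving f^[i] := by
  induction i with
  | zero => exact fun n x y h => h
  | succ i ih =>
    intro n x y h
    rw [Function.iterate_succ_apply, Function.iterate_succ_apply]
    exact ih n _ _ (hf n x y h)

theorem CongrPreserving.inducedMod_toZModPow (hf : CongrPreserving f) (x : ℤ_[2]) :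
    inducedMod f n (toZModPow n x) = toZModPow n (f x) := by
  rw [inducedMod, toZModPow_two_eq_iff]
  apply hf
  rw [← toZModPow_two_eq_iff, map_natCast, ZMod.natCast_zmod_val]

theorem CongrPreserving.inducedMod_iterate (hf : CongrPreserving f) (i : ℕ) (x : ℤ_[2]) :
    (inducedMod f n)^[i] (toZModPow n x) = toZModPow n (f^[i] x) := by
  induction i generalizing x with
  | zero => rfl
  | succ i ih =>
    rw [Function.iterate_succ_apply, hf.inducedMod_toZModPow, ih, Function.iterate_succ_apply]

theorem CongrPreserving.transitiveMod_iff (hf : CongrPreserving f) :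
    TransitiveMod f n ↔ ∀ x : ℤ_[2], ∃ i : ℕ, 2 ^ n ∣ f^[i] 0 - x := by
  have h0 : (0 : ZMod (2 ^ n)) = toZModPow n 0 := (map_zero _).symm
  simp only [TransitiveMod, h0, hf.inducedMod_iterate, ← toZModPow_two_eq_iff]
  refine ⟨fun h x => h _, fun h z => ?_⟩
  simpa using h z.val

theorem CongrPreserving.isPeriodicPt_iff (hf : CongrPreserving f) (i : ℕ) :
    Function.IsPeriodicPt (inducedMod f n) i 0 ↔ 2 ^ n ∣ f^[i] 0 := by
  have h := hf.inducedMod_iterate (n := n) i 0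
  rw [map_zero] at h
  rw [Function.IsPeriodicPt, Function.IsFixedPt, h, ← map_zero (toZModPow n),
    toZModPow_two_eq_iff, sub_zero]

theorem CongrPreserving.fullPeriod_of_transitiveMod_succ (hf : CongrPreserving f)
    (h : TransitiveMod f (n + 1)) : FullPeriod f n := by
  rw [hf.transitiveMod_iff] at h
  have hdvd : (2 : ℤ_[2]) ^ n ∣ 2 ^ (n + 1) := pow_dvd_pow _ n.le_succ
  have htrans : TransitiveMod f n := by
    rw [hf.transitiveMod_iff]
    exact fun x => (h x).imp fun i hi => hdvd.trans hi
  have hper : (0 : ZMod (2 ^ n)) ∈ Function.periodicPts (inducedMod f n) := by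
    obtain ⟨i, hi⟩ := h (2 ^ n)
    refine ⟨i, Nat.pos_of_ne_zero ?_, ?_⟩
    · rintro rfl
      rw [Function.iterate_zero_apply, zero_sub, dvd_neg] at hi
      exact not_two_pow_succ_dvd_two_pow n hi
    · rw [hf.isPeriodicPt_iff]
      exact (dvd_sub_left (dvd_refl _)).1 (hdvd.trans hi)
  have hcard : Function.minimalPeriod (inducedMod f n) 0 = 2 ^ n := by
    apply le_antisymm
    · simpa using Function.minimalPeriod_le_card (f := inducedMod f n) (x := 0)
    · have hpos := Function.minimalPeriod_pos_of_mem_periodicPts hper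
      have hsurj : Finset.univ ⊆ (Finset.range (Function.minimalPeriod (inducedMod f n) 0)).image
          (fun i => (inducedMod f n)^[i] 0) := by
        intro z _
        obtain ⟨i, hi⟩ := htrans z
        rw [Finset.mem_image]
        refine ⟨_, Finset.mem_range.2 (Nat.mod_lt i hpos), ?_⟩
        rw [Function.iterate_mod_minimalPeriod_eq, hi]
      simpa using (Finset.card_le_card hsurj).trans Finset.card_image_le
  intro i
  rw [← hf.isPeriodicPt_iff, Function.isPeriodicPt_iff_minimalPeriod_dvd, hcard]

theorem FullPeriod.iterate_injOn (h : FullPeriod f n) (hf : CongrPreserving f) {i j : ℕ}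
    (hi : i < 2 ^ n) (hj : j < 2 ^ n) (hij : 2 ^ n ∣ f^[i] 0 - f^[j] 0) : i = j := by
  wlog hle : i ≤ j generalizing i j
  · exact (this hj hi ((dvd_sub_comm).1 hij) (le_of_not_ge hle)).symm
  have h1 := hf.iterate (2 ^ n - j) n _ _ hij
  rw [← Function.iterate_add_apply, ← Function.iterate_add_apply, Nat.sub_add_cancel hj.le] at h1
  have h2 := (h _).1 ((dvd_sub_left ((h _).2 dvd_rfl)).1 h1)
  have h3 := Nat.le_of_dvd (by omega) h2
  omega

theorem FullPeriod.iterate_surjOn (h : FullPeriod f n) (hf : CongrPreserving f) (x : ℤ_[2]) :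
    ∃ i < 2 ^ n, 2 ^ n ∣ f^[i] 0 - x := by
  have hinj : Set.InjOn (fun i : ℕ => toZModPow n (f^[i] 0))
      (Finset.range (2 ^ n) : Finset ℕ) := by
    intro i hi j hj hij
    rw [Finset.mem_coe, Finset.mem_range] at hi hj
    exact h.iterate_injOn hf hi hj ((toZModPow_two_eq_iff _ _ _).1 hij)
  obtain ⟨i, hi, hix⟩ := Finset.surj_on_of_inj_on_of_card_le
    (s := Finset.range (2 ^ n)) (t := (Finset.univ : Finset (ZMod (2 ^ n))))
    (fun i _ => toZModPow n (f^[i] 0)) (fun _ _ => Finset.mem_univ _)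
    (fun i j hi hj hij => hinj hi hj hij) (by simp) (toZModPow n x) (Finset.mem_univ _)
  exact ⟨i, Finset.mem_range.1 hi, (toZModPow_two_eq_iff _ _ _).1 hix.symm⟩

theorem FullPeriod.transitiveMod (h : FullPeriod f n) (hf : CongrPreserving f) :
    TransitiveMod f n :=
  hf.transitiveMod_iff.2 fun x => (h.iterate_surjOn hf x).imp fun _ hi => hi.2

theorem FullPeriod.dvd_sub_of_dvd_map_sub (h : FullPeriod f n) (hf : CongrPreserving f)
    {x y : ℤ_[2]} (hxy : 2 ^ n ∣ f x - f y) : 2 ^ n ∣ x - y := by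
  have hsurj : Function.Surjective (inducedMod f n) := by
    intro z
    obtain ⟨x, rfl⟩ : ∃ x, toZModPow n x = z := ⟨(z.val : ℤ_[2]), by simp⟩
    obtain ⟨i, hi⟩ := hf.transitiveMod_iff.1 (h.transitiveMod hf) x
    obtain ⟨j, hj⟩ : ∃ j, f^[j + 1] 0 = f^[i + 2 ^ n] 0 :=
      ⟨i + 2 ^ n - 1, by rw [Nat.sub_add_cancel (by have := Nat.two_pow_pos n; omega)]⟩
    refine ⟨toZModPow n (f^[j] 0), ?_⟩
    rw [hf.inducedMod_toZModPow, toZModPow_two_eq_iff, ← Function.iterate_succ_apply' f j 0,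
      Nat.succ_eq_add_one, hj, Function.iterate_add_apply]
    have h1 := hf.iterate i n (f^[2 ^ n] 0) 0 (by rw [sub_zero]; exact (h _).2 dvd_rfl)
    simpa using dvd_add h1 hi
  have hinj := Finite.injective_iff_surjective.2 hsurj
  rw [← toZModPow_two_eq_iff] at hxy ⊢
  rw [← hf.inducedMod_toZModPow, ← hf.inducedMod_toZModPow] at hxy
  exact hinj hxy

/-- A congruence preserving map which is injective modulo `2 ^ (n + 1)` on every residue class
modulo `2 ^ n` commutes with translation by `2 ^ n` modulo `2 ^ (n + 1)`. -/
theorem CongrPreserving.commutesTranslation (hf : CongrPreserving f)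
    (hinj : ∀ x y : ℤ_[2], 2 ^ n ∣ x - y → 2 ^ (n + 1) ∣ f x - f y → 2 ^ (n + 1) ∣ x - y) :
    CommutesTranslation f n := by
  intro x y hxy
  by_cases h : 2 ^ (n + 1) ∣ x - y
  · exact dvd_sub (hf _ _ _ h) h
  · have h1 := two_pow_succ_dvd_sub_two_pow hxy h
    have h2 := two_pow_succ_dvd_sub_two_pow (hf _ _ _ hxy) (fun h' => h (hinj x y hxy h'))
    simpa using dvd_sub h2 h1

theorem CongrPreserving.commutesTranslation_of_natCast (hf : CongrPreserving f)
    (h : ∀ x < 2 ^ n, ¬ 2 ^ (n + 1) ∣ f ((x + 2 ^ n : ℕ) : ℤ_[2]) - f x) :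
    CommutesTranslation f n := by
  refine hf.commutesTranslation fun x y hxy hfxy => ?_
  have hx := two_pow_dvd_sub_appr (n + 1) x
  have hy := two_pow_dvd_sub_appr (n + 1) y
  have hxlt := x.appr_lt (n + 1)
  have hylt := y.appr_lt (n + 1)
  generalize x.appr (n + 1) = a at hx hxlt
  generalize y.appr (n + 1) = b at hy hylt
  have hdvd : (2 : ℤ_[2]) ^ n ∣ 2 ^ (n + 1) := pow_dvd_pow _ n.le_succ
  have hab : (2 : ℤ_[2]) ^ n ∣ (a : ℤ_[2]) - b := by
    have e : (a : ℤ_[2]) - b = (x - y) - (x - a) + (y - b) := by ring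
    rw [e]
    exact dvd_add (dvd_sub hxy (hdvd.trans hx)) (hdvd.trans hy)
  have hfab : (2 : ℤ_[2]) ^ (n + 1) ∣ f a - f b := by
    have e : f a - f b = (f x - f y) - (f x - f a) + (f y - f b) := by ring
    rw [e]
    exact dvd_add (dvd_sub hfxy (hf _ _ _ hx)) (hf _ _ _ hy)
  have heq : a = b := by
    clear hx hy hfxy hxy
    wlog hle : a ≤ b generalizing a b
    · exact (this b hylt a hxlt (dvd_sub_comm.1 hab) (dvd_sub_comm.1 hfab)
        (le_of_not_ge hle)).symm
    rw [dvd_sub_comm, ← Nat.cast_sub hle, two_pow_dvd_natCast] at hab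
    obtain ⟨c, hc⟩ := hab
    rw [pow_succ] at hxlt hylt
    have hc2 : c < 2 := by
      by_contra! hc2
      have := Nat.mul_le_mul_left (2 ^ n) hc2
      omega
    interval_cases c
    · omega
    · obtain rfl : b = a + 2 ^ n := by omega
      exact absurd (dvd_sub_comm.1 hfab) (h a (by omega))
  subst heq
  simpa using dvd_sub hx hy

theorem CommutesTranslation.iterate (h : CommutesTranslation f n) (i : ℕ) :
    CommutesTranslation f^[i] n := by
  induction i with
  | zero => intro x y _; simp
  | succ i ih =>
    intro x y hxy
    have h1 := h x y hxy
    have h2 : 2 ^ n ∣ f x - f y := by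
      simpa using dvd_add ((pow_dvd_pow _ n.le_succ).trans h1) hxy
    rw [Function.iterate_succ_apply, Function.iterate_succ_apply]
    simpa using dvd_add (ih _ _ h2) h1

theorem FullPeriod.dvd_iterate_sub_displacementSum (h : FullPeriod f n) (hf : CongrPreserving f)
    (hc : CommutesTranslation f n) :
    2 ^ (n + 1) ∣ f^[2 ^ n] 0 - displacementSum f n := by
  have hsum : f^[2 ^ n] 0 = ∑ i ∈ Finset.range (2 ^ n), (f (f^[i] 0) - f^[i] 0) := by
    simp only [← Function.iterate_succ_apply']
    rw [Finset.sum_range_sub (fun i => f^[i] 0), Function.iterate_zero_apply, sub_zero]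
  rw [← toZModPow_two_eq_iff, hsum, displacementSum, map_sum, map_sum]
  refine Finset.sum_bij (fun i _ => (f^[i] 0).appr n)
    (fun i _ => Finset.mem_range.2 (appr_lt _ _)) ?_ ?_ ?_
  · intro i hi j hj hij
    refine h.iterate_injOn hf (Finset.mem_range.1 hi) (Finset.mem_range.1 hj) ?_
    have h1 := two_pow_dvd_sub_appr n (f^[i] 0)
    rw [hij] at h1
    simpa using dvd_sub h1 (two_pow_dvd_sub_appr n (f^[j] 0))
  · intro r hr
    obtain ⟨i, hi, hir⟩ := h.iterate_surjOn hf (r : ℤ_[2])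
    refine ⟨i, Finset.mem_range.2 hi, ?_⟩
    have h1 := dvd_sub hir (two_pow_dvd_sub_appr n (f^[i] 0))
    rw [sub_sub_sub_cancel_left, ← toZModPow_two_eq_iff, map_natCast, map_natCast,
      ZMod.natCast_eq_natCast_iff'] at h1
    rwa [Nat.mod_eq_of_lt (appr_lt _ _), Nat.mod_eq_of_lt (Finset.mem_range.1 hr)] at h1
  · intro i _
    rw [toZModPow_two_eq_iff]
    have h1 := hc _ _ (two_pow_dvd_sub_appr n (f^[i] 0))
    rwa [sub_sub_sub_comm]

theorem FullPeriod.succ (h : FullPeriod f n) (hf : CongrPreserving f)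
    (hc : CommutesTranslation f n) (hs : 2 ^ (n + 1) ∣ displacementSum f n - 2 ^ n) :
    FullPeriod f (n + 1) := by
  have h1 : 2 ^ (n + 1) ∣ f^[2 ^ n] 0 - 2 ^ n := by
    simpa using dvd_add (h.dvd_iterate_sub_displacementSum hf hc) hs
  have h2 (q : ℕ) : 2 ^ (n + 1) ∣ f^[2 ^ n * q] 0 - ((2 ^ n * q : ℕ) : ℤ_[2]) := by
    induction q with
    | zero => simp
    | succ q ih =>
      have h3 := hf.iterate (2 ^ n * q) _ _ _ h1
      have h4 := hc.iterate (2 ^ n * q) (2 ^ n) 0 (by simp)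
      rw [mul_add_one, Function.iterate_add_apply]
      convert dvd_add (dvd_add h3 h4) ih using 1
      push_cast
      ring
  intro i
  have hred (hi : 2 ^ n ∣ i) : 2 ^ (n + 1) ∣ f^[i] 0 ↔ 2 ^ (n + 1) ∣ i := by
    obtain ⟨q, rfl⟩ := hi
    rw [← two_pow_dvd_natCast]
    exact dvd_iff_dvd_of_dvd_sub (h2 q)
  exact ⟨fun hi => (hred ((h i).1 ((pow_dvd_pow _ n.le_succ).trans hi))).1 hi,
    fun hi => (hred ((pow_dvd_pow _ n.le_succ).trans hi)).2 hi⟩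

theorem FullPeriod.commutesTranslation (h : FullPeriod f (n + 1)) (hf : CongrPreserving f) :
    CommutesTranslation f n :=
  hf.commutesTranslation fun _ _ _ hxy => h.dvd_sub_of_dvd_map_sub hf hxy

theorem FullPeriod.dvd_displacementSum_sub (h : FullPeriod f n) (h' : FullPeriod f (n + 1))
    (hf : CongrPreserving f) : 2 ^ (n + 1) ∣ displacementSum f n - 2 ^ n := by
  have h1 := h.dvd_iterate_sub_displacementSum hf (h'.commutesTranslation hf)
  have h2 : 2 ^ (n + 1) ∣ f^[2 ^ n] 0 - 2 ^ n := by
    refine two_pow_succ_dvd_sub_two_pow ((h _).2 dvd_rfl) fun hd => ?_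
    have := (h' _).1 hd
    rw [Nat.pow_dvd_pow_iff_le_right (by norm_num)] at this
    omega
  simpa using dvd_sub h2 h1

/-- Ergodicity of a 1-Lipschitz map, expressed through its values at natural numbers. -/
theorem CongrPreserving.forall_transitiveMod_iff (hf : CongrPreserving f) :
    (∀ k : ℕ, 1 ≤ k → TransitiveMod f k) ↔
      ∀ n : ℕ, CommutesTranslation f n ∧ 2 ^ (n + 1) ∣ displacementSum f n - 2 ^ n := by
  constructor
  · intro h n
    have hfull (k : ℕ) : FullPeriod f k :=
      hf.fullPeriod_of_transitiveMod_succ (h (k + 1) (by omega))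
    exact ⟨(hfull (n + 1)).commutesTranslation hf,
      (hfull n).dvd_displacementSum_sub (hfull (n + 1)) hf⟩
  · intro h k _
    refine FullPeriod.transitiveMod ?_ hf
    clear * - h hf
    induction k with
    | zero => intro i; simp
    | succ n ih => exact ih.succ hf (h n).1 (h n).2

end Dynamics

section VanDerPut

theorem vdpChi_natCast (m x : ℕ) :
    vdpChi m x = if x % 2 ^ (Nat.log 2 m + 1) = m then 1 else 0 := by
  have h := two_pow_dvd_iff_norm_le (Nat.log 2 m + 1) ((x : ℤ_[2]) - m)
  rw [← toZModPow_two_eq_iff, map_natCast, map_natCast, ZMod.natCast_eq_natCast_iff',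
    Nat.mod_eq_of_lt (Nat.lt_pow_succ_log_self one_lt_two m)] at h
  push_cast at h
  rw [vdpChi]
  simp only [h]

variable {B : ℕ → ℤ_[2]} {f : ℤ_[2] → ℤ_[2]}

theorem vdp_natCast (hf : ∀ x : ℤ_[2], f x = ∑' m : ℕ, B m * vdpChi m x) {x N : ℕ} (hx : x < N) :
    f x = ∑ m ∈ Finset.range N, B m * vdpChi m x := by
  rw [hf]
  refine tsum_eq_sum fun m hm => ?_
  rw [Finset.mem_range, not_lt] at hm
  rw [vdpChi_natCast, if_neg, mul_zero]
  have := Nat.mod_le x (2 ^ (Nat.log 2 m + 1))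
  omega

theorem vdp_zero (hf : ∀ x : ℤ_[2], f x = ∑' m : ℕ, B m * vdpChi m x) : f 0 = B 0 := by
  have h := vdp_natCast hf zero_lt_one
  rw [Finset.sum_range_one, vdpChi_natCast] at h
  simpa using h

theorem vdp_one (hf : ∀ x : ℤ_[2], f x = ∑' m : ℕ, B m * vdpChi m x) : f 1 = B 1 := by
  have h := vdp_natCast hf one_lt_two
  simp only [vdpChi_natCast] at h
  simpa using h

theorem vdp_coeff (hf : ∀ x : ℤ_[2], f x = ∑' m : ℕ, B m * vdpChi m x) {n x : ℕ} (hn : 1 ≤ n)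
    (hx : x < 2 ^ n) : B (x + 2 ^ n) = f ((x + 2 ^ n : ℕ) : ℤ_[2]) - f x := by
  rw [vdp_natCast hf (Nat.lt_succ_self (x + 2 ^ n)),
    vdp_natCast hf (show x < (x + 2 ^ n).succ by omega), ← Finset.sum_sub_distrib,
    Finset.sum_eq_single (x + 2 ^ n)]
  · have hlog : Nat.log 2 (x + 2 ^ n) = n := by
      rw [Nat.log_eq_iff (by omega)]
      rw [pow_succ]
      omega
    rw [vdpChi_natCast, vdpChi_natCast, hlog, Nat.mod_eq_of_lt (by rw [pow_succ]; omega),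
      Nat.mod_eq_of_lt (by rw [pow_succ]; omega), if_pos rfl, if_neg (by omega)]
    ring
  · intro m hm hne
    rw [Finset.mem_range] at hm
    rw [vdpChi_natCast, vdpChi_natCast]
    rcases lt_or_ge (Nat.log 2 m) n with hlog | hlog
    · have hmod : (x + 2 ^ n) % 2 ^ (Nat.log 2 m + 1) = x % 2 ^ (Nat.log 2 m + 1) := by
        obtain ⟨c, hc⟩ := pow_dvd_pow 2 (Nat.succ_le_of_lt hlog)
        rw [hc, Nat.succ_eq_add_one, Nat.add_mul_mod_self_left]
      rw [hmod, sub_self]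
    · have hpow : 2 ^ (n + 1) ≤ 2 ^ (Nat.log 2 m + 1) :=
        Nat.pow_le_pow_right two_pos (by omega)
      have hm0 : m ≠ 0 := by
        rintro rfl
        simp at hlog
        omega
      have hle : 2 ^ n ≤ m :=
        (Nat.pow_le_pow_right two_pos hlog).trans (Nat.pow_log_le_self 2 hm0)
      rw [pow_succ 2 n] at hpow
      rw [Nat.mod_eq_of_lt (by omega), Nat.mod_eq_of_lt (by omega), if_neg (by omega),
        if_neg (by omega)]
      ring
  · simp

theorem displacementSum_succ (hf : ∀ x : ℤ_[2], f x = ∑' m : ℕ, B m * vdpChi m x) {n : ℕ}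
    (hn : 1 ≤ n) : displacementSum f (n + 1) =
      2 * displacementSum f n + ∑ m ∈ Finset.Ico (2 ^ n) (2 ^ (n + 1)), (B m - 2 ^ n) := by
  have e : 2 ^ (n + 1) = 2 ^ n + 2 ^ n := by rw [pow_succ]; omega
  rw [displacementSum, displacementSum, Finset.sum_Ico_eq_sum_range, e, Finset.sum_range_add,
    Nat.add_sub_cancel, two_mul, add_assoc, add_right_inj, ← Finset.sum_add_distrib]
  refine Finset.sum_congr rfl fun x hx => ?_
  rw [add_comm (2 ^ n) x, vdp_coeff hf hn (Finset.mem_range.1 hx)]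
  push_cast
  ring

end VanDerPut

/-- **Ergodicity criterion in terms of van der Put coefficients.** A T-function (1-Lipschitz
function) `f : ℤ_2 → ℤ_2` with van der Put series `f x = Σ' m, B m · χ(m,x)` is transitive
modulo `2^k` for every `k ≥ 1` (i.e. ergodic) if and only if (1) `B_0 ≡ 1 (mod 2)`;
(2) `B_0 + B_1 ≡ 3 (mod 4)`; (3) `‖B m‖ = 2^{-(n-1)}` whenever `n ≥ 2`,
`2^{n-1} ≤ m < 2^n − 1`; (4) `‖Σ_{m=2^{n−1}}^{2^n−1} (B_m − 2^{n−1})‖ ≤ 2^{-(n+1)}`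
for every `n ≥ 2`. -/
theorem vdp_ergodicity_criterion
    (B : ℕ → ℤ_[2]) (hB : Tendsto B atTop (nhds 0))
    (f : ℤ_[2] → ℤ_[2]) (hlip : ∀ a b : ℤ_[2], ‖f a - f b‖ ≤ ‖a - b‖)
    (hf : ∀ x : ℤ_[2], f x = ∑' m : ℕ, B m * vdpChi m x) :
    (∀ k : ℕ, 1 ≤ k → TransitiveMod f k) ↔
      ((2 : ℤ_[2]) ∣ (B 0 - 1) ∧
       (4 : ℤ_[2]) ∣ (B 0 + B 1 - 3) ∧
       (∀ n m : ℕ, 2 ≤ n → 2 ^ (n - 1) ≤ m → m < 2 ^ n - 1 →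
          ‖B m‖ = (2 : ℝ) ^ (-((n : ℤ) - 1))) ∧
       (∀ n : ℕ, 2 ≤ n →
          ‖∑ m ∈ Finset.Ico (2 ^ (n - 1)) (2 ^ n), (B m - 2 ^ (n - 1))‖ ≤
            (2 : ℝ) ^ (-((n : ℤ) + 1)))) := by
  have hc : CongrPreserving f := .of_norm_le hlip
  have hD0 : displacementSum f 0 = B 0 := by simp [displacementSum, vdp_zero hf]
  have hD1 : displacementSum f 1 = B 0 + B 1 - 1 := by
    simp [displacementSum, Finset.sum_range_succ, vdp_zero hf, vdp_one hf]
  have hpow (n : ℕ) : (2 : ℤ_[2]) ^ (n + 2) = 2 * 2 ^ (n + 1) := by ring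
  rw [hc.forall_transitiveMod_iff]
  constructor
  · intro h
    refine ⟨?_, ?_, ?_, ?_⟩
    · simpa [hD0] using (h 0).2
    · have h1 := (h 1).2
      rw [hD1] at h1
      convert h1 using 1 <;> ring
    · rintro n m hn hm hm'
      obtain ⟨n, rfl⟩ : ∃ k, n = k + 1 := ⟨n - 1, by omega⟩
      rw [Nat.add_sub_cancel] at hm
      obtain ⟨x, rfl⟩ : ∃ x, m = x + 2 ^ n := ⟨m - 2 ^ n, by omega⟩
      rw [pow_succ] at hm'
      have e : -(((n + 1 : ℕ) : ℤ) - 1) = -(n : ℤ) := by push_cast; ring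
      rw [e, norm_eq_two_zpow_iff, vdp_coeff hf (by omega) (by omega)]
      have hx : ((x + 2 ^ n : ℕ) : ℤ_[2]) - x = 2 ^ n := by push_cast; ring
      have h2 : (2 : ℤ_[2]) ^ n ∣ ((x + 2 ^ n : ℕ) : ℤ_[2]) - x := by rw [hx]
      refine ⟨hc _ _ _ h2, fun h3 => not_two_pow_succ_dvd_two_pow n ?_⟩
      have h4 := (h n).1 _ _ h2
      rw [hx] at h4
      exact (dvd_iff_dvd_of_dvd_sub h4).1 h3
    · intro n hn
      obtain ⟨n, rfl⟩ : ∃ k, n = k + 1 := ⟨n - 1, by omega⟩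
      rw [Nat.add_sub_cancel]
      have h1 := (two_pow_dvd_iff_norm_le (n + 1 + 1)
        (∑ m ∈ Finset.Ico (2 ^ n) (2 ^ (n + 1)), (B m - 2 ^ n))).1 ?_
      · exact_mod_cast h1
      have h2 := (h (n + 1)).2
      have h3 := mul_dvd_mul_left 2 (h n).2
      rw [← hpow] at h3
      rw [displacementSum_succ hf (by omega)] at h2
      convert dvd_sub h2 h3 using 1
      ring
  · rintro ⟨h1, h2, h3, h4⟩
    have hsum (n : ℕ) (hn : 1 ≤ n) :
        2 ^ (n + 2) ∣ ∑ m ∈ Finset.Ico (2 ^ n) (2 ^ (n + 1)), (B m - 2 ^ n) := by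
      rw [two_pow_dvd_iff_norm_le]
      have h := h4 (n + 1) (by omega)
      rw [Nat.add_sub_cancel] at h
      exact_mod_cast h
    have hB' (n m : ℕ) (hn : 1 ≤ n) (hm : 2 ^ n ≤ m) (hm' : m < 2 ^ (n + 1) - 1) :
        2 ^ (n + 1) ∣ B m - 2 ^ n := by
      have h := h3 (n + 1) m (by omega) (by simpa using hm) hm'
      have e : -(((n + 1 : ℕ) : ℤ) - 1) = -(n : ℤ) := by push_cast; ring
      rw [e, norm_eq_two_zpow_iff] at h
      exact two_pow_succ_dvd_sub_two_pow h.1 h.2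
    have hlast (n m : ℕ) (hn : 1 ≤ n) (hm : 2 ^ n ≤ m) (hm' : m < 2 ^ (n + 1)) :
        2 ^ (n + 1) ∣ B m - 2 ^ n := by
      rcases Nat.lt_or_ge m (2 ^ (n + 1) - 1) with hlt | hge
      · exact hB' n m hn hm hlt
      obtain rfl : m = 2 ^ (n + 1) - 1 := by omega
      have h := (pow_dvd_pow (2 : ℤ_[2]) (n + 1).le_succ).trans (hsum n hn)
      rw [← Finset.add_sum_erase _ _ (Finset.mem_Ico.2 ⟨hm, hm'⟩)] at h
      refine (dvd_add_left (Finset.dvd_sum fun j hj => ?_)).1 h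
      rw [Finset.mem_erase, Finset.mem_Ico] at hj
      exact hB' n j hn hj.2.1 (by omega)
    intro n
    constructor
    · apply hc.commutesTranslation_of_natCast
      intro x hx hdvd
      rcases Nat.eq_zero_or_pos n with rfl | hn
      · obtain rfl : x = 0 := by omega
        have h5 : (2 : ℤ_[2]) ∣ B 1 - B 0 := by
          simpa [vdp_zero hf, vdp_one hf] using hdvd
        have h6 : (2 : ℤ_[2]) ∣ B 0 + B 1 - 3 := Dvd.dvd.trans ⟨2, by norm_num⟩ h2
        refine not_two_pow_succ_dvd_two_pow 0 ?_
        have e : (2 : ℤ_[2]) ^ 0 = (B 1 - B 0) - (B 0 + B 1 - 3) + 2 * (B 0 - 1) := by ring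
        rw [e, zero_add, pow_one]
        exact dvd_add (dvd_sub h5 h6) (dvd_mul_right _ _)
      · rw [← vdp_coeff hf hn hx] at hdvd
        have h5 := hlast n (x + 2 ^ n) hn (by omega) (by rw [pow_succ]; omega)
        exact not_two_pow_succ_dvd_two_pow n ((dvd_iff_dvd_of_dvd_sub h5).1 hdvd)
    · induction n with
      | zero => simpa [hD0] using h1
      | succ n ih =>
        rcases Nat.eq_zero_or_pos n with rfl | hn
        · rw [zero_add, hD1]
          convert h2 using 1 <;> ring
        · have h5 := mul_dvd_mul_left 2 ih
          rw [← hpow] at h5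
          rw [displacementSum_succ hf hn]
          convert dvd_add h5 (hsum n hn) using 1
          ring
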